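/- Let w be a sufficiently smooth function on ℝ^{1+2} supported in the cone K solving the wave equation -□w = F_w. Then one has the extra decay estimate for the Hessian of w: for all (t,x) ∈ K, max_{α,β∈{0,1,2}} |∂_α∂_β w(t,x)| ≲ (t/s²) Σ_{|I| ≤ 1} |∂Γ^I w(t,x)| + (t²/s²) |F_w(t,x)|, where s = √(t²−|x|²) and the implied constant is independent of w, t, x. -/

import Mathlib

open MeasureTheory Real Filter Topology
open scoped ENNReal NNReal

noncomputable section

/-- A spacetime point in `ℝ^{1+2}`: coordinates `(x₀, x₁, x₂)` with `t = x₀`. -/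
abbrev Pt : Type := Fin 3 → ℝ

/-- The `i`-th standard basis vector of `ℝ^{1+2}`. -/
def e3 (i : Fin 3) : Pt := Pi.single i 1

/-- Partial derivative `∂_i`. -/
def pd (i : Fin 3) (u : Pt → ℝ) : Pt → ℝ := fun p => fderiv ℝ u p (e3 i)

/-- Spatial radius `r = |x|`. -/
def rad (p : Pt) : ℝ := Real.sqrt ((p 1) ^ 2 + (p 2) ^ 2)

/-- Hyperbolic time `s = √(t² − |x|²)`. -/
def sVar (p : Pt) : ℝ := Real.sqrt ((p 0) ^ 2 - (p 1) ^ 2 - (p 2) ^ 2)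

/-- The cone `K = {(t,x) : t ≥ 2, |x| < t − 1}`. -/
def Cone : Set Pt := {p | 2 ≤ p 0 ∧ rad p < p 0 - 1}

/-- Lorentz boost `L_a = x_a ∂_t + t ∂_a`, `a ∈ {1,2}`. -/
def Lb (a : Fin 2) (u : Pt → ℝ) : Pt → ℝ :=
  fun p => p a.succ * pd 0 u p + p 0 * pd a.succ u p

/-- Semi-hyperboloidal derivative `∂̲_a = (x_a/t)∂_t + ∂_a`. -/
def dund (a : Fin 2) (u : Pt → ℝ) : Pt → ℝ :=
  fun p => (p a.succ / p 0) * pd 0 u p + pd a.succ u p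

/-- The ordered family `{Γ_k} = {∂₀, ∂₁, ∂₂, L₁, L₂}`. -/
def Gam : Fin 5 → (Pt → ℝ) → (Pt → ℝ) := ![pd 0, pd 1, pd 2, Lb 0, Lb 1]

/-- `Γ^I = Π_k Γ_k^{i_k}` for a multi-index `I ∈ ℕ⁵`. -/
def GamI (I : Fin 5 → ℕ) : (Pt → ℝ) → (Pt → ℝ) :=
  (Gam 0)^[I 0] ∘ (Gam 1)^[I 1] ∘ (Gam 2)^[I 2] ∘ (Gam 3)^[I 3] ∘ (Gam 4)^[I 4]

/-- Length `|I|` of a multi-index. -/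
def mlen (I : Fin 5 → ℕ) : ℕ := ∑ k, I k

/-- The (finite) set of multi-indices `I ∈ ℕ⁵` with `|I| ≤ n`. -/
def midxLe (n : ℕ) : Finset (Fin 5 → ℕ) :=
  (Fintype.piFinset fun _ => Finset.range (n + 1)).filter fun I => mlen I ≤ n

/-- The (finite) set of multi-indices `I ∈ ℕ⁵` with `|I| = 1`. -/
def midxEq1 : Finset (Fin 5 → ℕ) :=
  (Fintype.piFinset fun _ => Finset.range 2).filter fun I => mlen I = 1

/-- `|∂u| = (Σ_α |∂_α u|²)^{1/2}`. -/
def pdNorm (u : Pt → ℝ) (p : Pt) : ℝ := Real.sqrt (∑ α, (pd α u p) ^ 2)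

/-- The wave operator `□ = −∂_t² + ∂₁² + ∂₂²`. -/
def box (u : Pt → ℝ) : Pt → ℝ :=
  fun p => - pd 0 (pd 0 u) p + pd 1 (pd 1 u) p + pd 2 (pd 2 u) p

/-- The null condition for constants `P^{γαβ}`. -/
def NullCond (P : Fin 3 → Fin 3 → Fin 3 → ℝ) : Prop :=
  ∀ ξ : Fin 3 → ℝ, ξ 0 ^ 2 = ξ 1 ^ 2 + ξ 2 ^ 2 →
    ∑ γ, ∑ α, ∑ β, P γ α β * ξ γ * ξ α * ξ β = 0

/-- The symmetry condition `P^{γαβ} = P^{γβα}`. -/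
def SymmCond (P : Fin 3 → Fin 3 → Fin 3 → ℝ) : Prop := ∀ γ α β, P γ α β = P γ β α

/-- Null form `N(w,z) = P^{γαβ} ∂_γ w ∂_α∂_β z`. -/
def Nform (P : Fin 3 → Fin 3 → Fin 3 → ℝ) (w z : Pt → ℝ) : Pt → ℝ :=
  fun p => ∑ γ, ∑ α, ∑ β, P γ α β * pd γ w p * pd α (pd β z) p

/-- The point of the hyperboloid `H_s` above `x ∈ ℝ²`. -/
def hypPt (s : ℝ) (x : Fin 2 → ℝ) : Pt :=
  ![Real.sqrt (s ^ 2 + (x 0) ^ 2 + (x 1) ^ 2), x 0, x 1]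

/-- `‖u‖_{L²_f(H_s)}`. -/
def L2H (u : Pt → ℝ) (s : ℝ) : ℝ :=
  (∫ x : Fin 2 → ℝ, (u (hypPt s x)) ^ 2) ^ (1 / 2 : ℝ)

/-- The hyperboloidal energy `E_m(u,s)`. -/
def Em (m : ℝ) (u : Pt → ℝ) (s : ℝ) : ℝ :=
  ∫ x : Fin 2 → ℝ,
    (((s / hypPt s x 0) * pd 0 u (hypPt s x)) ^ 2
      + ∑ a : Fin 2, (dund a u (hypPt s x)) ^ 2
      + m ^ 2 * (u (hypPt s x)) ^ 2)

/-- `K₀ = s∂_s + 2x^a∂̲_a`, where `s∂_s = (s²/t)∂_t`. -/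
def K0op (u : Pt → ℝ) : Pt → ℝ :=
  fun p => (sVar p) ^ 2 / p 0 * pd 0 u p + 2 * ∑ a : Fin 2, p a.succ * dund a u p

/-- The conformal energy `E_con(u,s)`. -/
def Econ (u : Pt → ℝ) (s : ℝ) : ℝ :=
  ∫ x : Fin 2 → ℝ,
    ((K0op u (hypPt s x) + u (hypPt s x)) ^ 2
      + ∑ a : Fin 2, (s * dund a u (hypPt s x)) ^ 2)


theorem contDiff_pd {w : Pt → ℝ} (hw : ContDiff ℝ (⊤ : ℕ∞) w) (i : Fin 3) :
    ContDiff ℝ (⊤ : ℕ∞) (pd i w) :=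
  (hw.fderiv_right (m := (⊤ : ℕ∞)) (by simp)).clm_apply contDiff_const

theorem differentiable_pd {w : Pt → ℝ} (hw : ContDiff ℝ (⊤ : ℕ∞) w) (i : Fin 3) :
    Differentiable ℝ (pd i w) :=
  (contDiff_pd hw i).differentiable (by simp)

theorem pd_pd_eq {w : Pt → ℝ} (hw : ContDiff ℝ (⊤ : ℕ∞) w) (i j : Fin 3) (p : Pt) :
    pd i (pd j w) p = fderiv ℝ (fderiv ℝ w) p (e3 i) (e3 j) := by
  have hd : DifferentiableAt ℝ (fderiv ℝ w) p :=
    (hw.fderiv_right (m := (⊤ : ℕ∞)) (by simp)).differentiable (by simp) p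
  change fderiv ℝ (fun q => fderiv ℝ w q (e3 j)) p (e3 i) = _
  rw [fderiv_clm_apply hd (differentiableAt_const _)]
  simp

theorem pd_pd_comm {w : Pt → ℝ} (hw : ContDiff ℝ (⊤ : ℕ∞) w) (i j : Fin 3) (p : Pt) :
    pd i (pd j w) p = pd j (pd i w) p := by
  rw [pd_pd_eq hw, pd_pd_eq hw]
  exact ((contDiff_infty.mp hw 2).contDiffAt.isSymmSndFDerivAt (by simp)).eq _ _

theorem pd_coord_mul {f : Pt → ℝ} {p : Pt} (hf : DifferentiableAt ℝ f p) (γ i : Fin 3) :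
    pd γ (fun q => q i * f q) p = e3 γ i * f p + p i * pd γ f p := by
  have hc : HasFDerivAt (fun q : Pt => q i) (ContinuousLinearMap.proj (R := ℝ) i) p :=
    hasFDerivAt_apply i p
  have hm : fderiv ℝ (fun q : Pt => q i * f q) p = _ := (hc.mul hf.hasFDerivAt).fderiv
  unfold pd
  rw [hm]
  simp
  ring

/-- The commutator identity for a translation and a boost. -/
theorem pd_Lb {w : Pt → ℝ} (hw : ContDiff ℝ (⊤ : ℕ∞) w) (a : Fin 2) (γ : Fin 3) (p : Pt) :
    pd γ (Lb a w) p = e3 γ a.succ * pd 0 w p + p a.succ * pd γ (pd 0 w) p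
      + (e3 γ 0 * pd a.succ w p + p 0 * pd γ (pd a.succ w) p) := by
  have h0 := differentiable_pd hw 0 p
  have ha := differentiable_pd hw a.succ p
  rw [← pd_coord_mul h0, ← pd_coord_mul ha]
  have hsum := fderiv_add (𝕜 := ℝ) (f := fun q : Pt => q a.succ * pd 0 w q)
    (g := fun q : Pt => q 0 * pd a.succ w q) (x := p)
    ((differentiableAt_apply _ _).mul h0) ((differentiableAt_apply _ _).mul ha)
  exact congrArg (fun L => L (e3 γ)) hsum

theorem abs_pd_le_pdNorm (u : Pt → ℝ) (γ : Fin 3) (p : Pt) : |pd γ u p| ≤ pdNorm u p :=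
  Real.abs_le_sqrt <| Finset.single_le_sum (f := fun α => (pd α u p) ^ 2)
    (fun _ _ => sq_nonneg _) (Finset.mem_univ γ)

theorem pdNorm_GamI_le_sum {n : ℕ} {I : Fin 5 → ℕ} (hI : I ∈ midxLe n) (w : Pt → ℝ) (p : Pt) :
    pdNorm (GamI I w) p ≤ ∑ J ∈ midxLe n, pdNorm (GamI J w) p :=
  Finset.single_le_sum (f := fun J => pdNorm (GamI J w) p) (fun _ _ => Real.sqrt_nonneg _) hI

theorem pdNorm_le_sum (w : Pt → ℝ) (p : Pt) :
    pdNorm w p ≤ ∑ I ∈ midxLe 1, pdNorm (GamI I w) p := by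
  simpa [GamI] using
    pdNorm_GamI_le_sum (n := 1) (I := 0) (by decide) w p

theorem pdNorm_Lb_le_sum (a : Fin 2) (w : Pt → ℝ) (p : Pt) :
    pdNorm (Lb a w) p ≤ ∑ I ∈ midxLe 1, pdNorm (GamI I w) p := by
  fin_cases a
  · exact pdNorm_GamI_le_sum (n := 1) (I := ![0, 0, 0, 1, 0]) (by decide) w p
  · exact pdNorm_GamI_le_sum (n := 1) (I := ![0, 0, 0, 0, 1]) (by decide) w p

theorem abs_e3_mul_le (i j : Fin 3) (x : ℝ) : |e3 i j * x| ≤ |x| := by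
  by_cases h : j = i
  · subst h; simp [e3]
  · simp [e3, h]

/-- A boost applied to a gradient component is controlled by first-order vector fields. -/
theorem abs_boost_pd_le {w : Pt → ℝ} (hw : ContDiff ℝ (⊤ : ℕ∞) w) (a : Fin 2) (γ : Fin 3)
    (p : Pt) :
    |p a.succ * pd γ (pd 0 w) p + p 0 * pd γ (pd a.succ w) p|
      ≤ 3 * ∑ I ∈ midxLe 1, pdNorm (GamI I w) p := by
  have h1 := (abs_pd_le_pdNorm (Lb a w) γ p).trans (pdNorm_Lb_le_sum a w p)
  have h2 := ((abs_e3_mul_le γ a.succ _).trans (abs_pd_le_pdNorm w 0 p)).trans (pdNorm_le_sum w p)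
  have h3 := ((abs_e3_mul_le γ 0 _).trans (abs_pd_le_pdNorm w a.succ p)).trans (pdNorm_le_sum w p)
  rw [pd_Lb hw] at h1
  rw [abs_le] at *
  constructor <;> linarith

theorem abs_coord_le_of_mem_Cone {p : Pt} (hp : p ∈ Cone) (a : Fin 2) : |p a.succ| ≤ p 0 := by
  have hr : |p a.succ| ≤ rad p := by
    refine Real.abs_le_sqrt ?_
    fin_cases a
    · change p 1 ^ 2 ≤ _
      linarith [sq_nonneg (p 2)]
    · change p 2 ^ 2 ≤ _
      linarith [sq_nonneg (p 1)]
  linarith [hp.2]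

theorem sVar_sq_of_mem_Cone {p : Pt} (hp : p ∈ Cone) :
    0 < sVar p ^ 2 ∧ sVar p ^ 2 = p 0 ^ 2 - p 1 ^ 2 - p 2 ^ 2 := by
  have h0 : 0 ≤ rad p := Real.sqrt_nonneg _
  have hr : rad p ^ 2 = p 1 ^ 2 + p 2 ^ 2 := Real.sq_sqrt (by positivity)
  have hpos : 0 < p 0 ^ 2 - p 1 ^ 2 - p 2 ^ 2 := by nlinarith [hp.1, hp.2]
  have hs : sVar p ^ 2 = p 0 ^ 2 - p 1 ^ 2 - p 2 ^ 2 := Real.sq_sqrt hpos.le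
  exact ⟨hs ▸ hpos, hs⟩

/-- Transfer of a weighted bound along a relation `x * h + t * k = O(S)` with `|x| ≤ t`. -/
theorem abs_mul_le_of_boost {t x σ h k S M : ℝ} (ht : 0 < t) (hx : |x| ≤ t) (hσ : 0 ≤ σ)
    (hσt : σ ≤ t ^ 2) (hB : |x * h + t * k| ≤ 3 * S) (hM : |σ * h| ≤ M) :
    |σ * k| ≤ M + 3 * t * S := by
  have hS : 0 ≤ 3 * S := (abs_nonneg _).trans hB
  have key : t * |σ * k| ≤ t * (M + 3 * t * S) := by
    calc t * |σ * k| = |σ * (x * h + t * k) - x * (σ * h)| := by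
          rw [← abs_of_pos ht, ← abs_mul, abs_of_pos ht]; congr 1; ring
      _ ≤ |σ * (x * h + t * k)| + |x * (σ * h)| := abs_sub _ _
      _ = σ * |x * h + t * k| + |x| * |σ * h| := by rw [abs_mul, abs_mul x, abs_of_nonneg hσ]
      _ ≤ t ^ 2 * (3 * S) + t * M := by gcongr
      _ = _ := by ring
  exact le_of_mul_le_mul_left key ht

/-- The wave equation and the boosts control the second time derivative. -/
theorem abs_mul_pd_zero_zero_le {w : Pt → ℝ} (hw : ContDiff ℝ (⊤ : ℕ∞) w) {p : Pt}
    (hp : p ∈ Cone) :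
    |sVar p ^ 2 * pd 0 (pd 0 w) p|
      ≤ p 0 ^ 2 * |box w p| + 12 * p 0 * ∑ I ∈ midxLe 1, pdNorm (GamI I w) p := by
  set S := ∑ I ∈ midxLe 1, pdNorm (GamI I w) p
  have ht : 0 < p 0 := by linarith [hp.1]
  have hd (a : Fin 2) : |p 0 * (p a.succ * pd a.succ (pd 0 w) p
        + p 0 * pd a.succ (pd a.succ w) p)
      - p a.succ * (p a.succ * pd 0 (pd 0 w) p + p 0 * pd 0 (pd a.succ w) p)| ≤ 6 * p 0 * S := by
    have h1 := abs_boost_pd_le hw a a.succ p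
    have h2 := abs_boost_pd_le hw a 0 p
    have hx := abs_coord_le_of_mem_Cone hp a
    refine (abs_sub _ _).trans ?_
    rw [abs_mul, abs_mul (p a.succ), abs_of_pos ht]
    calc _ ≤ p 0 * (3 * S) + p 0 * (3 * S) := by gcongr
      _ = _ := by ring
  have h1 := hd 0
  have h2 := hd 1
  simp only [pd_pd_comm hw (Fin.succ _) 0] at h1 h2
  have hF : |p 0 ^ 2 * box w p| = p 0 ^ 2 * |box w p| := by
    rw [abs_mul, abs_of_nonneg (sq_nonneg _)]
  have hF' := hF.le
  rw [(sVar_sq_of_mem_Cone hp).2]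
  simp only [show Fin.succ (0 : Fin 2) = 1 from rfl, show Fin.succ (1 : Fin 2) = 2 from rfl]
    at h1 h2
  have hbox : p 0 ^ 2 * box w p = p 0 ^ 2 * (- pd 0 (pd 0 w) p + pd 1 (pd 1 w) p
    + pd 2 (pd 2 w) p) := rfl
  rw [abs_le] at *
  constructor <;> linarith

/-- extra decay for the Hessian of a solution of the wave equation `−□w = F_w`. -/
theorem hessian_extra_decay :
    ∃ C > (0:ℝ), ∀ w Fw : Pt → ℝ,
      ContDiff ℝ (⊤ : ℕ∞) w → Function.support w ⊆ Cone →
      (∀ p : Pt, - box w p = Fw p) →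
      ∀ p ∈ Cone, ∀ α β : Fin 3,
        |pd α (pd β w) p| ≤
          C * ((p 0 / (sVar p) ^ 2) * ∑ I ∈ midxLe 1, pdNorm (GamI I w) p
            + ((p 0) ^ 2 / (sVar p) ^ 2) * |Fw p|) := by
  refine ⟨18, by norm_num, fun w Fw hw _ hF p hp α β => ?_⟩
  set S := ∑ I ∈ midxLe 1, pdNorm (GamI I w) p
  have ht : 0 < p 0 := by linarith [hp.1]
  have hS : 0 ≤ S := (Real.sqrt_nonneg _).trans (pdNorm_le_sum w p)
  obtain ⟨hs, hs_eq⟩ := sVar_sq_of_mem_Cone hp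
  have hst : sVar p ^ 2 ≤ p 0 ^ 2 := by nlinarith [sq_nonneg (p 1), sq_nonneg (p 2)]
  have h00 := abs_mul_pd_zero_zero_le hw hp
  rw [show |box w p| = |Fw p| by rw [← hF p, abs_neg]] at h00
  have h0 (a : Fin 2) := abs_mul_le_of_boost ht (abs_coord_le_of_mem_Cone hp a) hs.le hst
    (abs_boost_pd_le hw a 0 p) h00
  have hab (a b : Fin 2) := abs_mul_le_of_boost ht (abs_coord_le_of_mem_Cone hp b) hs.le hst
    (abs_boost_pd_le hw b a.succ p) (pd_pd_comm hw 0 a.succ p ▸ h0 a)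
  have hpS : 0 ≤ p 0 * S := by positivity
  have hbound : |sVar p ^ 2 * pd α (pd β w) p| ≤ p 0 ^ 2 * |Fw p| + 18 * (p 0 * S) := by
    induction α using Fin.cases with
    | zero =>
      induction β using Fin.cases with
      | zero => linarith
      | succ b => linarith [h0 b]
    | succ a =>
      induction β using Fin.cases with
      | zero => rw [pd_pd_comm hw]; linarith [h0 a]
      | succ b => linarith [hab a b]
  rw [abs_mul, abs_of_pos hs, mul_comm, ← le_div_iff₀ hs] at hbound
  refine hbound.trans ?_
  rw [div_mul_eq_mul_div, div_mul_eq_mul_div, ← add_div, ← mul_div_assoc]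
  gcongr
  have : 0 ≤ p 0 ^ 2 * |Fw p| := by positivity
  linarith
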